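/- Let I be a monomial ideal in k[ℕA] and F a face of A such that I has a standard pair belonging to F. Let S = {b ∈ ℕA : b divides some element of a + ℕF for some standard pair (a,F) of I belonging to F whose overlap class is maximal with respect to divisibility}. Then ℕA ∖ S is the exponent set of a monomial ideal C_F of k[ℕA], I ⊆ C_F, and C_F is p_F-primary. -/

import Mathlib

open scoped BigOperators

namespace StdPairsPaper

/-- The coercion of a lattice point to a real vector. -/
def toR {d : ℕ} (v : Fin d → ℤ) : Fin d → ℝ := fun i => (v i : ℝ)

/-- The cone of nonnegative real combinations of (the real images of) elements of `S`. -/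
def cone {d : ℕ} (S : Set (Fin d → ℤ)) : Set (Fin d → ℝ) :=
  {x | ∃ (t : Finset (Fin d → ℤ)) (c : (Fin d → ℤ) → ℝ),
    (t : Set (Fin d → ℤ)) ⊆ S ∧ (∀ v, 0 ≤ c v) ∧ x = ∑ v ∈ t, c v • toR v}

/-- `ℕS`, the submonoid of `ℤ^d` generated by `S`. -/
def NSemi {d : ℕ} (S : Set (Fin d → ℤ)) : AddSubmonoid (Fin d → ℤ) :=
  AddSubmonoid.closure S

/-- `ℤS`, the subgroup of `ℤ^d` generated by `S`. -/
def ZGrp {d : ℕ} (S : Set (Fin d → ℤ)) : AddSubgroup (Fin d → ℤ) :=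
  AddSubgroup.closure S

/-- `ℝS`, the real linear span of `S`. -/
def RSpan {d : ℕ} (S : Set (Fin d → ℤ)) : Submodule ℝ (Fin d → ℝ) :=
  Submodule.span ℝ (toR '' S)

/-- `A` is a configuration: a finite set of nonzero lattice points whose `ℤ`-span is `ℤ^d`
and whose nonnegative real cone is strongly convex (contains no line, i.e. is pointed). -/
structure IsConfig {d : ℕ} (A : Set (Fin d → ℤ)) : Prop where
  (finite : A.Finite)
  (nonzero : (0 : Fin d → ℤ) ∉ A)
  (spans : ZGrp A = ⊤)
  (pointed : ∀ x ∈ cone A, -x ∈ cone A → x = 0)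

/-- `F` is a face of the configuration `A`: `F ⊆ A`, the cone over `F` is an extreme
subset (face) of the cone over `A`, and `ℝ_{≥0}F ∩ A = F`. -/
def IsFace {d : ℕ} (A F : Set (Fin d → ℤ)) : Prop :=
  F ⊆ A ∧ IsExtreme ℝ (cone A) (cone F) ∧ cone F ∩ (toR '' A) = toR '' F

/-- The set `a + ℕF`. -/
def cell {d : ℕ} (a : Fin d → ℤ) (F : Set (Fin d → ℤ)) : Set (Fin d → ℤ) :=
  {x | ∃ f ∈ NSemi F, x = a + f}

/-- Two pairs `(a,F)` and `(b,F)` belonging to the same face `F` overlap: `a - b ∈ ℤF`. -/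
def Overlap {d : ℕ} (F : Set (Fin d → ℤ)) (a b : Fin d → ℤ) : Prop :=
  a - b ∈ ZGrp F

/-- The pair `(a,F)` divides the pair `(b,G)`:
there is `c ∈ ℕA` with `a + c + ℕF ⊆ b + ℕG`. -/
def PairDvd {d : ℕ} (A : Set (Fin d → ℤ)) (a : Fin d → ℤ) (F : Set (Fin d → ℤ))
    (b : Fin d → ℤ) (G : Set (Fin d → ℤ)) : Prop :=
  ∃ c ∈ NSemi A, cell (a + c) F ⊆ cell b G

/-- `E` is the exponent set of a monomial ideal of `ℕA`: `E ⊆ ℕA` and `E + ℕA ⊆ E`. -/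
def IsExpSet {d : ℕ} (A E : Set (Fin d → ℤ)) : Prop :=
  E ⊆ (NSemi A : Set (Fin d → ℤ)) ∧ ∀ e ∈ E, ∀ c ∈ NSemi A, e + c ∈ E

/-- The standard monomials of `E`: `ℕA ∖ E`. -/
def stdSet {d : ℕ} (A E : Set (Fin d → ℤ)) : Set (Fin d → ℤ) :=
  (NSemi A : Set (Fin d → ℤ)) \ E

/-- `(a,F)` is a proper pair of `E`: a pair of `A` with `a + ℕF ⊆ std(E)`. -/
def ProperPair {d : ℕ} (A E : Set (Fin d → ℤ)) (a : Fin d → ℤ)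
    (F : Set (Fin d → ℤ)) : Prop :=
  a ∈ NSemi A ∧ IsFace A F ∧ cell a F ⊆ stdSet A E

/-- `(a,F)` is a standard pair of `E`: a proper pair of `E` maximal with respect to
the partial order `(a,F) ≼ (b,G) ↔ a + ℕF ⊆ b + ℕG`. -/
def StdPair {d : ℕ} (A E : Set (Fin d → ℤ)) (a : Fin d → ℤ)
    (F : Set (Fin d → ℤ)) : Prop :=
  ProperPair A E a F ∧
    ∀ b G, ProperPair A E b G → cell a F ⊆ cell b G → cell b G ⊆ cell a F

/-- The overlap class of the standard pair `(a,F)` of `E` is maximal with respect to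
divisibility among overlap classes of standard pairs of `E`. -/
def MaxClass {d : ℕ} (A E : Set (Fin d → ℤ)) (a : Fin d → ℤ)
    (F : Set (Fin d → ℤ)) : Prop :=
  ∀ b G, StdPair A E b G → PairDvd A a F b G → PairDvd A b G a F

noncomputable section

/-- The affine semigroup ring `k[ℕA]`. -/
abbrev SGRing {d : ℕ} (k : Type*) [Field k] (A : Set (Fin d → ℤ)) :=
  AddMonoidAlgebra k (NSemi A)

/-- The monomial `t^a` of `k[ℕA]`. -/
def mono {d : ℕ} (k : Type*) [Field k] (A : Set (Fin d → ℤ)) (a : (NSemi A)) :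
    SGRing k A :=
  AddMonoidAlgebra.single a 1

/-- `I` is a monomial ideal of `k[ℕA]`: an ideal generated by monomials. -/
def IsMonomialIdeal {d : ℕ} (k : Type*) [Field k] (A : Set (Fin d → ℤ))
    (I : Ideal (SGRing k A)) : Prop :=
  ∃ S : Set (NSemi A), I = Ideal.span ((fun a => mono k A a) '' S)

/-- The exponent set `E(I) = {a ∈ ℕA : t^a ∈ I}` of an ideal of `k[ℕA]`,
as a subset of `ℤ^d`. -/
def expSet {d : ℕ} (k : Type*) [Field k] (A : Set (Fin d → ℤ))
    (I : Ideal (SGRing k A)) : Set (Fin d → ℤ) :=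
  {x | ∃ h : x ∈ NSemi A, mono k A ⟨x, h⟩ ∈ I}

/-- The monomial prime ideal `p_F = ⟨t^a : a ∈ ℕA ∖ ℕF⟩` of `k[ℕA]`. -/
def primeF {d : ℕ} (k : Type*) [Field k] (A F : Set (Fin d → ℤ)) :
    Ideal (SGRing k A) :=
  Ideal.span {x | ∃ a : (NSemi A), (a : Fin d → ℤ) ∉ NSemi F ∧ x = mono k A a}

end

/-- Finitely many positive reals can be sent to positive rationals by a `ℚ`-linear map. -/
theorem exists_ratLinear_pos (s : Finset ℝ) (hs : ∀ x ∈ s, 0 < x) :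
    ∃ f : ℝ →ₗ[ℚ] ℚ, ∀ x ∈ s, 0 < f x := by
  let B := Module.Basis.ofVectorSpace ℚ ℝ
  let Φ : ℝ → (Module.Basis.ofVectorSpaceIndex ℚ ℝ → ℝ) → ℝ :=
    fun x r => ∑ j ∈ (B.repr x).support, ((B.repr x j : ℚ) : ℝ) * r j
  have hΦ : ∀ x, Continuous (Φ x) := fun x => by fun_prop
  have hopen : IsOpen {r | ∀ x ∈ s, 0 < Φ x r} := by
    have : {r | ∀ x ∈ s, 0 < Φ x r} = ⋂ x ∈ s, {r | 0 < Φ x r} := by ext; simp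
    rw [this]
    exact isOpen_biInter_finset fun x _ => isOpen_lt continuous_const (hΦ x)
  have hB : ∀ x, Φ x B = x := fun x => by
    have h := B.linearCombination_repr x
    rw [Finsupp.linearCombination_apply, Finsupp.sum] at h
    simpa [Φ, Rat.smul_def] using h
  have hdense : DenseRange (Pi.map fun (_ : Module.Basis.ofVectorSpaceIndex ℚ ℝ) (q : ℚ) =>
      (q : ℝ)) := DenseRange.piMap fun _ => Rat.denseRange_cast
  obtain ⟨q, hq⟩ := hdense.exists_mem_open hopen ⟨B, fun x hx => by rw [hB]; exact hs x hx⟩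
  refine ⟨B.constr ℚ q, fun x hx => ?_⟩
  have h := hq x hx
  simp only [Φ, Pi.map_apply] at h
  rw [Module.Basis.constr_apply, Finsupp.sum]
  simp only [smul_eq_mul]
  exact_mod_cast h

/-- A real linear relation among lattice points can be replaced by an integral one, keeping
positive coefficients positive and vanishing coefficients zero. -/
theorem exists_int_relation {d : ℕ} (T : Finset (Fin d → ℤ)) (e : (Fin d → ℤ) → ℝ)
    (he : ∑ v ∈ T, e v • toR v = 0) :
    ∃ n : (Fin d → ℤ) → ℤ, ∑ v ∈ T, n v • v = 0 ∧
      ∀ v ∈ T, (0 < e v → 0 < n v) ∧ (e v = 0 → n v = 0) := by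
  classical
  obtain ⟨f, hf⟩ := exists_ratLinear_pos ((T.image e).filter (0 < ·)) (by simp)
  have hrel : ∀ i, ∑ v ∈ T, f (e v) * (v i : ℚ) = 0 := fun i => by
    have h := congrArg f (congrFun he i)
    simp only [Finset.sum_apply, Pi.smul_apply, toR, smul_eq_mul, Pi.zero_apply, map_zero,
      map_sum] at h
    rw [← h]
    refine Finset.sum_congr rfl fun v _ => ?_
    rw [mul_comm (e v), ← zsmul_eq_mul, map_zsmul, zsmul_eq_mul, mul_comm]
  let M : ℕ := ∏ v ∈ T, (f (e v)).den
  have hM : 0 < M := Finset.prod_pos fun v _ => (f (e v)).den_pos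
  have hint : ∀ v ∈ T, ∃ m : ℤ, (m : ℚ) = M * f (e v) := fun v hv => by
    obtain ⟨k, hk⟩ : (f (e v)).den ∣ M := Finset.dvd_prod_of_mem _ hv
    refine ⟨k * (f (e v)).num, ?_⟩
    rw [hk]
    push_cast
    rw [mul_comm ((f (e v)).den : ℚ), mul_assoc, Rat.den_mul_eq_num]
  choose! n hn using hint
  have hM' : (0 : ℚ) < M := by exact_mod_cast hM
  refine ⟨n, ?_, fun v hv => ⟨fun h => ?_, fun h => ?_⟩⟩
  · ext i
    have : ∑ v ∈ T, (n v : ℚ) * (v i : ℚ) = 0 := by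
      rw [Finset.sum_congr rfl fun v hv => by rw [hn v hv, mul_assoc], ← Finset.mul_sum, hrel i,
        mul_zero]
    simp only [Finset.sum_apply, Pi.smul_apply, smul_eq_mul, Pi.zero_apply]
    exact_mod_cast this
  · have : 0 < f (e v) := hf _ (by simp [h]; exact ⟨v, hv, rfl⟩)
    have : (0 : ℚ) < n v := by rw [hn v hv]; positivity
    exact_mod_cast this
  · have : (n v : ℚ) = 0 := by rw [hn v hv, h, map_zero, mul_zero]
    exact_mod_cast this

theorem toR_add {d : ℕ} (v w : Fin d → ℤ) : toR (v + w) = toR v + toR w := by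
  ext i; simp [toR]

theorem toR_injective {d : ℕ} : Function.Injective (toR (d := d)) := fun v w h => by
  ext i
  have := congrFun h i
  simp only [toR] at this
  exact_mod_cast this

theorem toR_mem_cone {d : ℕ} {S : Set (Fin d → ℤ)} {v : Fin d → ℤ} (hv : v ∈ S) :
    toR v ∈ cone S :=
  ⟨{v}, fun _ => 1, by simpa using hv, fun _ => zero_le_one, by simp⟩

theorem cone_mono {d : ℕ} {S T : Set (Fin d → ℤ)} (h : S ⊆ T) : cone S ⊆ cone T :=
  fun _ ⟨t, c, ht, hc, hx⟩ => ⟨t, c, ht.trans h, hc, hx⟩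

theorem smul_mem_cone {d : ℕ} {S : Set (Fin d → ℤ)} {x : Fin d → ℝ} (hx : x ∈ cone S)
    {r : ℝ} (hr : 0 ≤ r) : r • x ∈ cone S := by
  obtain ⟨t, c, ht, hc, rfl⟩ := hx
  exact ⟨t, fun v => r * c v, ht, fun v => mul_nonneg hr (hc v), by
    simp [Finset.smul_sum, mul_smul]⟩

/-- Membership in the cone over a subset of a finite set `T`, with all coefficients
indexed by `T`. -/
theorem mem_cone_iff {d : ℕ} {S : Set (Fin d → ℤ)} {T : Finset (Fin d → ℤ)}
    (hST : S ⊆ T) {x : Fin d → ℝ} :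
    x ∈ cone S ↔ ∃ c : (Fin d → ℤ) → ℝ, (∀ v, 0 ≤ c v) ∧ (∀ v ∉ S, c v = 0) ∧
      x = ∑ v ∈ T, c v • toR v := by
  classical
  constructor
  · rintro ⟨t, c, ht, hc, rfl⟩
    refine ⟨fun v => if v ∈ t then c v else 0, fun v => ?_, fun v hv => ?_, ?_⟩
    · dsimp only; split_ifs <;> simp [hc]
    · exact if_neg fun h => hv (ht h)
    · rw [← Finset.sum_subset (show t ⊆ T from fun v hv => by exact_mod_cast hST (ht hv))]
      · exact Finset.sum_congr rfl fun v hv => by simp [hv]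
      · exact fun v _ hv => by simp [hv]
  · rintro ⟨c, hc, hcS, rfl⟩
    refine ⟨T.filter (· ∈ S), c, fun v hv => (by simpa using hv : v ∈ T ∧ v ∈ S).2, hc, ?_⟩
    rw [Finset.sum_filter]
    refine Finset.sum_congr rfl fun v _ => ?_
    split_ifs with h
    · rfl
    · rw [hcS v h, zero_smul]

theorem add_mem_cone {d : ℕ} {S : Set (Fin d → ℤ)} (hS : S.Finite) {x y : Fin d → ℝ}
    (hx : x ∈ cone S) (hy : y ∈ cone S) : x + y ∈ cone S := by
  have hT : S ⊆ hS.toFinset := by simp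
  rw [mem_cone_iff hT] at *
  obtain ⟨c, hc, hcS, rfl⟩ := hx
  obtain ⟨e, he, heS, rfl⟩ := hy
  exact ⟨fun v => c v + e v, fun v => add_nonneg (hc v) (he v),
    fun v hv => by simp [hcS v hv, heS v hv], by simp [add_smul, Finset.sum_add_distrib]⟩

theorem toR_mem_cone_of_mem_NSemi {d : ℕ} {S : Set (Fin d → ℤ)} (hS : S.Finite)
    {x : Fin d → ℤ} (hx : x ∈ NSemi S) : toR x ∈ cone S := by
  induction hx using AddSubmonoid.closure_induction with
  | mem v hv => exact toR_mem_cone hv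
  | zero => exact ⟨∅, 0, by simp, fun _ => le_rfl, by ext; simp [toR]⟩
  | add x y _ _ hx hy => rw [toR_add]; exact add_mem_cone hS hx hy

section Face

variable {d : ℕ} {A F : Set (Fin d → ℤ)}

theorem IsFace.mem_of_toR_mem_cone (hF : IsFace A F) {v : Fin d → ℤ} (hv : v ∈ A)
    (h : toR v ∈ cone F) : v ∈ F := by
  have : toR v ∈ toR '' F := hF.2.2 ▸ ⟨h, v, hv, rfl⟩
  exact (toR_injective.mem_set_image).1 this

theorem IsFace.mem_of_mem_NSemi (hA : A.Finite) (hF : IsFace A F) {v : Fin d → ℤ} (hv : v ∈ A)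
    (h : v ∈ NSemi F) : v ∈ F :=
  hF.mem_of_toR_mem_cone hv (toR_mem_cone_of_mem_NSemi (hA.subset hF.1) h)

theorem IsFace.NSemi_le (hF : IsFace A F) : NSemi F ≤ NSemi A := AddSubmonoid.closure_mono hF.1

/-- `ℕF` is a face of the monoid `ℕA`. -/
theorem IsFace.left_mem_of_add_mem (hA : A.Finite) (hF : IsFace A F) {x y : Fin d → ℤ}
    (hx : x ∈ NSemi A) (hy : y ∈ NSemi A) (h : x + y ∈ NSemi F) : x ∈ NSemi F := by
  induction hx using AddSubmonoid.closure_induction generalizing y with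
  | mem v hv =>
    refine AddSubmonoid.subset_closure (hF.mem_of_toR_mem_cone hv ?_)
    have h2 : (2 : ℝ) • toR v ∈ cone F := by
      refine hF.2.1.left_mem_of_mem_openSegment
        (smul_mem_cone (toR_mem_cone hv) zero_le_two)
        (smul_mem_cone (toR_mem_cone_of_mem_NSemi hA hy) zero_le_two)
        (toR_mem_cone_of_mem_NSemi (hA.subset hF.1) h)
        ⟨1 / 2, 1 / 2, by norm_num, by norm_num, by norm_num, ?_⟩
      rw [toR_add, smul_smul, smul_smul]
      norm_num
    have := smul_mem_cone h2 (show (0 : ℝ) ≤ 1 / 2 by norm_num)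
    rwa [smul_smul, one_div, inv_mul_cancel₀ two_ne_zero, one_smul] at this
  | zero => exact zero_mem _
  | add x₁ x₂ hx₁ hx₂ ih₁ ih₂ =>
    refine add_mem (ih₁ (y := x₂ + y) (add_mem hx₂ hy) ?_) (ih₂ (y := x₁ + y) (add_mem hx₁ hy) ?_)
    · rwa [← add_assoc]
    · rwa [add_left_comm, ← add_assoc]

end Face

/-- The elements of `A` dividing some multiple of `w`. -/
def divFace {d : ℕ} (A : Set (Fin d → ℤ)) (w : Fin d → ℤ) : Set (Fin d → ℤ) :=
  {g | g ∈ A ∧ ∃ N : ℕ, N • w - g ∈ NSemi A}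

section DivFace

variable {d : ℕ} {A : Set (Fin d → ℤ)} {w : Fin d → ℤ}

theorem exists_nsmul_sub_mem_of_mem_NSemi_divFace {x : Fin d → ℤ}
    (hx : x ∈ NSemi (divFace A w)) : ∃ N : ℕ, N • w - x ∈ NSemi A := by
  induction hx using AddSubmonoid.closure_induction with
  | mem v hv => exact hv.2
  | zero => exact ⟨0, by simp⟩
  | add x y _ _ hx hy =>
    obtain ⟨M, hM⟩ := hx
    obtain ⟨N, hN⟩ := hy
    refine ⟨M + N, ?_⟩
    rw [add_smul, add_sub_add_comm]
    exact add_mem hM hN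

theorem nonpos_of_relation_divFace (T : Finset (Fin d → ℤ)) (hT : (T : Set (Fin d → ℤ)) = A)
    {e : (Fin d → ℤ) → ℝ} (he : ∑ v ∈ T, e v • toR v = 0)
    (hpos : ∀ v ∉ divFace A w, 0 ≤ e v) {u : Fin d → ℤ} (hu : u ∈ A) (huw : u ∉ divFace A w) :
    e u ≤ 0 := by
  classical
  by_contra! hlt
  obtain ⟨n, hn, hsign⟩ := exists_int_relation T e he
  have huT : u ∈ T := by rw [← hT] at hu; exact_mod_cast hu
  have hTA : ∀ v ∈ T, v ∈ NSemi A := fun v hv =>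
    AddSubmonoid.subset_closure (hT ▸ (by exact_mod_cast hv))
  have hnn : ∀ v ∈ T, v ∉ divFace A w → (n v)⁻ = 0 := fun v hv hvw => by
    rw [negPart_eq_zero]
    rcases (hpos v hvw).lt_or_eq with h | h
    · exact ((hsign v hv).1 h).le
    · exact ((hsign v hv).2 h.symm).ge
  have hsplit : ∑ v ∈ T, (n v)⁺.toNat • v = ∑ v ∈ T, (n v)⁻.toNat • v := by
    rw [← sub_eq_zero, ← Finset.sum_sub_distrib, ← hn]
    refine Finset.sum_congr rfl fun v _ => ?_
    rw [← natCast_zsmul, ← natCast_zsmul, Int.toNat_of_nonneg (posPart_nonneg _),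
      Int.toNat_of_nonneg (negPart_nonneg _), ← sub_smul, posPart_sub_negPart]
  have hneg : ∑ v ∈ T, (n v)⁻.toNat • v ∈ NSemi (divFace A w) := by
    refine sum_mem fun v hv => ?_
    by_cases hvw : v ∈ divFace A w
    · exact nsmul_mem (AddSubmonoid.subset_closure hvw) _
    · rw [hnn v hv hvw]; simp
  obtain ⟨N, hN⟩ := exists_nsmul_sub_mem_of_mem_NSemi_divFace hneg
  refine huw ⟨hu, N, ?_⟩
  have h1 : 1 ≤ (n u)⁺.toNat := by
    have := (hsign u huT).1 hlt
    rw [posPart_of_nonneg this.le]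
    omega
  have hrest : ∑ v ∈ T, (n v)⁺.toNat • v - u ∈ NSemi A := by
    rw [← Finset.add_sum_erase T _ huT]
    obtain ⟨m, hm⟩ := Nat.exists_eq_add_of_le' h1
    rw [hm, add_smul, one_smul, add_right_comm, add_sub_cancel_right]
    exact add_mem (nsmul_mem (hTA u huT) _)
      (sum_mem fun v hv => nsmul_mem (hTA v (Finset.mem_of_mem_erase hv)) _)
  rw [hsplit] at hrest
  simpa using add_mem hN hrest

theorem isFace_divFace (hA : A.Finite) : IsFace A (divFace A w) := by
  classical
  have hsub : divFace A w ⊆ A := fun g hg => hg.1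
  have hT : ((hA.toFinset : Finset _) : Set (Fin d → ℤ)) = A := by simp
  have hAT : A ⊆ hA.toFinset := hT.ge
  refine ⟨hsub, ⟨cone_mono hsub, ?_⟩, ?_⟩
  · rintro x hx y hy z hz ⟨a, b, ha, hb, -, rfl⟩
    rw [mem_cone_iff hAT] at hx hy
    rw [mem_cone_iff (hsub.trans hAT)] at hz ⊢
    obtain ⟨c, hc, hcA, rfl⟩ := hx
    obtain ⟨c', hc', -, rfl⟩ := hy
    obtain ⟨e, he, heS, hz⟩ := hz
    refine ⟨c, hc, fun v hv => ?_, rfl⟩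
    by_cases hvA : v ∈ A
    · have hrel : ∑ v ∈ hA.toFinset, (a * c v + b * c' v - e v) • toR v = 0 := by
        simp only [sub_smul, add_smul, mul_smul, Finset.sum_sub_distrib, Finset.sum_add_distrib,
          ← Finset.smul_sum, hz, sub_self]
      have := nonpos_of_relation_divFace _ hT hrel (fun u hu => by
        rw [heS u hu]
        have := hc u; have := hc' u
        rw [sub_zero]
        positivity) hvA hv
      rw [heS v hv, sub_zero] at this
      have h1 := mul_nonneg hb.le (hc' v)
      have h2 := hc v
      by_contra hne
      have : 0 < a * c v := mul_pos ha (h2.lt_of_ne' hne)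
      linarith
    · exact hcA v hvA
  · ext x
    constructor
    · rintro ⟨hx, v, hv, rfl⟩
      refine ⟨v, ?_, rfl⟩
      by_contra hvw
      rw [mem_cone_iff (hsub.trans hAT)] at hx
      obtain ⟨e, he, heS, hz⟩ := hx
      have hrel : ∑ u ∈ hA.toFinset, ((if u = v then 1 else 0) - e u) • toR u = 0 := by
        simp [sub_smul, Finset.sum_sub_distrib, ← hz, ite_smul, hv]
      have := nonpos_of_relation_divFace _ hT hrel (fun u hu => by
        rw [heS u hu]
        split_ifs <;> simp) hv hvw
      rw [heS v hvw] at this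
      norm_num at this
    · rintro ⟨v, hv, rfl⟩
      exact ⟨toR_mem_cone hv, v, hv.1, rfl⟩

end DivFace

section WellQuasiOrder

variable {d : ℕ} {S : Set (Fin d → ℤ)}

theorem exists_sum_eq_of_mem_NSemi [Fintype S] {x : Fin d → ℤ} (hx : x ∈ NSemi S) :
    ∃ n : S → ℕ, x = ∑ v, n v • (v : Fin d → ℤ) := by
  classical
  induction hx using AddSubmonoid.closure_induction with
  | mem v hv => exact ⟨Pi.single ⟨v, hv⟩ 1, by simp [Pi.single_apply, ite_smul]⟩
  | zero => exact ⟨0, by simp⟩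
  | add x y _ _ hx hy =>
    obtain ⟨m, rfl⟩ := hx
    obtain ⟨n, rfl⟩ := hy
    exact ⟨m + n, by simp [add_smul, Finset.sum_add_distrib]⟩

theorem isPreorder_NSemi : IsPreorder (NSemi S) fun x y => (y - x : Fin d → ℤ) ∈ NSemi S where
  refl x := by simp
  trans x y z hxy hyz := by simpa using add_mem hyz hxy

/-- Dickson's lemma for divisibility in the monoid `ℕS`. -/
theorem wellQuasiOrdered_NSemi (hS : S.Finite) :
    WellQuasiOrdered fun x y : NSemi S => (y - x : Fin d → ℤ) ∈ NSemi S := by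
  intro f
  have := hS.fintype
  choose n hn using fun i => exists_sum_eq_of_mem_NSemi (f i).2
  obtain ⟨i, j, hij, hle⟩ := wellQuasiOrdered_le n
  refine ⟨i, j, hij, ?_⟩
  dsimp only
  rw [hn i, hn j, ← Finset.sum_sub_distrib]
  refine sum_mem fun v _ => ?_
  obtain ⟨m, hm⟩ := Nat.exists_eq_add_of_le (hle v)
  rw [hm, add_smul, add_sub_cancel_left]
  exact nsmul_mem (AddSubmonoid.subset_closure v.2) _

end WellQuasiOrder

/-- Divisibility of `b` by `a` in the localization `ℕA + ℤF`. -/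
def DvdMod {d : ℕ} (A F : Set (Fin d → ℤ)) (a b : Fin d → ℤ) : Prop :=
  ∃ c ∈ NSemi A, ∃ f ∈ NSemi F, a + c = b + f

section StdPair

variable {d : ℕ} {A E F G : Set (Fin d → ℤ)} {a b c v : Fin d → ℤ}

theorem self_mem_cell : a ∈ cell a F := ⟨0, zero_mem _, by simp⟩

theorem pairDvd_iff_dvdMod : PairDvd A a F b F ↔ DvdMod A F a b := by
  constructor
  · rintro ⟨c, hc, h⟩
    obtain ⟨f, hf, h⟩ := h self_mem_cell
    exact ⟨c, hc, f, hf, h⟩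
  · rintro ⟨c, hc, f, hf, h⟩
    refine ⟨c, hc, ?_⟩
    rintro _ ⟨g, hg, rfl⟩
    exact ⟨f + g, add_mem hf hg, by rw [h, add_assoc]⟩

theorem DvdMod.refl (a : Fin d → ℤ) : DvdMod A F a a :=
  ⟨0, zero_mem _, 0, zero_mem _, rfl⟩

theorem DvdMod.trans (h₁ : DvdMod A F a b) (h₂ : DvdMod A F b c) : DvdMod A F a c := by
  obtain ⟨x, hx, f, hf, h₁⟩ := h₁
  obtain ⟨y, hy, g, hg, h₂⟩ := h₂
  refine ⟨x + y, add_mem hx hy, f + g, add_mem hf hg, ?_⟩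
  rw [← add_assoc, h₁, add_right_comm, h₂, add_assoc, add_comm g]

theorem DvdMod.add_right (h : DvdMod A F a b) (u : Fin d → ℤ) : DvdMod A F (a + u) (b + u) := by
  obtain ⟨x, hx, f, hf, h⟩ := h
  exact ⟨x, hx, f, hf, by rw [add_right_comm, h, add_right_comm]⟩

theorem exists_mem_diff_sub_mem (hc : c ∈ NSemi A) (hcF : c ∉ NSemi F) :
    ∃ v ∈ A \ F, c - v ∈ NSemi A := by
  induction hc using AddSubmonoid.closure_induction with
  | mem v hv =>
    exact ⟨v, ⟨hv, fun h => hcF (AddSubmonoid.subset_closure h)⟩, by simp⟩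
  | zero => exact absurd (zero_mem _) hcF
  | add x y hx hy ihx ihy =>
    by_cases h : x ∈ NSemi F
    · obtain ⟨v, hv, hvy⟩ := ihy fun h' => hcF (add_mem h h')
      exact ⟨v, hv, by rw [add_sub_assoc]; exact add_mem hx hvy⟩
    · obtain ⟨v, hv, hvx⟩ := ihx h
      exact ⟨v, hv, by rw [add_sub_right_comm]; exact add_mem hvx hy⟩

theorem add_notMem_of_dvdMod (hE : IsExpSet A E) (hb : ProperPair A E b F)
    (h : DvdMod A F a b) : a ∉ E := by
  intro ha
  obtain ⟨c, hc, f, hf, h⟩ := h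
  exact (hb.2.2 ⟨f, hf, rfl⟩).2 (h ▸ hE.2 a ha c hc)

/-- A standard pair dividing another standard pair belongs to the same face. -/
theorem StdPair.face_eq_of_pairDvd (hA : A.Finite) (hE : IsExpSet A E) (ha : StdPair A E a F)
    (hb : StdPair A E b G) (h : PairDvd A a F b G) : G = F := by
  obtain ⟨c, hc, h⟩ := h
  obtain ⟨g, hg, hcg⟩ := h self_mem_cell
  have hF := ha.1.2.1
  have hG := hb.1.2.1
  have hFG : NSemi F ≤ NSemi G := fun f hf => by
    obtain ⟨g', hg', hfg⟩ := h ⟨f, hf, rfl⟩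
    rw [hcg, add_assoc, add_right_inj] at hfg
    refine hG.left_mem_of_add_mem hA (hF.NSemi_le hf) (hG.NSemi_le hg) ?_
    rw [add_comm, hfg]
    exact hg'
  have hproper : ProperPair A E a G := by
    refine ⟨ha.1.1, hG, ?_⟩
    rintro _ ⟨g', hg', rfl⟩
    exact ⟨add_mem ha.1.1 (hG.NSemi_le hg'), add_notMem_of_dvdMod hE hb.1
      ⟨c, hc, g + g', add_mem hg hg', by rw [add_right_comm, hcg, add_assoc]⟩⟩
  have hcell := ha.2 a G hproper fun x ⟨f, hf, hx⟩ => ⟨f, hFG hf, hx⟩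
  refine Set.Subset.antisymm (fun u hu => ?_) fun u hu => ?_
  · obtain ⟨f, hf, hx⟩ := hcell ⟨u, AddSubmonoid.subset_closure hu, rfl⟩
    rw [add_right_inj] at hx
    exact hF.mem_of_mem_NSemi hA (hG.1 hu) (hx ▸ hf)
  · exact hG.mem_of_mem_NSemi hA (hF.1 hu) (hFG (AddSubmonoid.subset_closure hu))

/-- If `v ∉ F`, some translate `a + Nv` of a standard pair `(a,F)` divides no proper pair
belonging to `F`. -/
theorem StdPair.exists_nsmul_not_dvdMod (hA : A.Finite) (hE : IsExpSet A E)
    (ha : StdPair A E a F) (hv : v ∈ A \ F) :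
    ∃ N : ℕ, ∀ b, ProperPair A E b F → ¬ DvdMod A F (a + N • v) b := by
  by_contra! hcon
  have hF := ha.1.2.1
  have hFfin := hA.subset hF.1
  let s : Fin d → ℤ := ∑ u ∈ hFfin.toFinset, u
  have hs : s ∈ NSemi F := sum_mem fun u hu => AddSubmonoid.subset_closure (by simpa using hu)
  let G := divFace A (s + v)
  have hvA : v ∈ NSemi A := AddSubmonoid.subset_closure hv.1
  have hvG : v ∈ G := ⟨hv.1, 1, by simpa using hF.NSemi_le hs⟩
  have hFG : F ⊆ G := fun u hu => by
    refine ⟨hF.1 hu, 1, ?_⟩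
    rw [one_smul, add_sub_right_comm]
    refine add_mem ?_ hvA
    simp only [s]
    rw [← Finset.add_sum_erase _ _ (hFfin.mem_toFinset.2 hu), add_sub_cancel_left]
    refine sum_mem fun w hw => AddSubmonoid.subset_closure (hF.1 ?_)
    simpa using Finset.mem_of_mem_erase hw
  have hG : IsFace A G := isFace_divFace hA
  have hproper : ProperPair A E a G := by
    refine ⟨ha.1.1, hG, ?_⟩
    rintro _ ⟨g, hg, rfl⟩
    refine ⟨add_mem ha.1.1 (hG.NSemi_le hg), ?_⟩
    obtain ⟨N, hN⟩ := exists_nsmul_sub_mem_of_mem_NSemi_divFace hg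
    obtain ⟨b, hb, c, hc, f, hf, h⟩ := hcon N
    refine add_notMem_of_dvdMod hE hb ⟨N • (s + v) - g + c, add_mem hN hc, N • s + f,
      add_mem (nsmul_mem hs N) hf, ?_⟩
    rw [add_left_comm b, ← h, smul_add]
    abel
  obtain ⟨f, hf, hx⟩ := ha.2 a G hproper (fun x ⟨f, hf, hx⟩ =>
    ⟨f, AddSubmonoid.closure_mono hFG hf, hx⟩) ⟨v, AddSubmonoid.subset_closure hvG, rfl⟩
  rw [add_right_inj] at hx
  exact hv.2 (hF.mem_of_mem_NSemi hA hv.1 (hx ▸ hf))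

theorem exists_maxClass (hA : A.Finite) (hE : IsExpSet A E) (ha : StdPair A E a F) :
    ∃ b, StdPair A E b F ∧ MaxClass A E b F := by
  by_contra! hcon
  have hstep : ∀ x : {x // StdPair A E x F}, ∃ y : {y // StdPair A E y F}, ∃ v : ↥(A \ F),
      DvdMod A F (x + v) y := by
    rintro ⟨x, hx⟩
    have := hcon x hx
    simp only [MaxClass, not_forall] at this
    obtain ⟨y, G, hy, hxy, hyx⟩ := this
    obtain rfl := hx.face_eq_of_pairDvd hA hE hy hxy
    rw [pairDvd_iff_dvdMod] at hxy hyx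
    obtain ⟨c, hc, f, hf, h⟩ := hxy
    have hcF : c ∉ NSemi G := fun hcF =>
      hyx ⟨f, hy.1.2.1.NSemi_le hf, c, hcF, h.symm⟩
    obtain ⟨v, hv, hcv⟩ := exists_mem_diff_sub_mem hc hcF
    exact ⟨⟨y, hy⟩, ⟨v, hv⟩, c - v, hcv, f, hf, by rw [← h]; abel⟩
  choose next v hnext using hstep
  let seq : ℕ → {x // StdPair A E x F} := fun n => next^[n] ⟨a, ha⟩
  have hseq : ∀ n, DvdMod A F (seq n + v (seq n)) (seq (n + 1)) := fun n => by
    simp only [seq, Function.iterate_succ_apply']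
    exact hnext _
  have hmono : ∀ m n, m ≤ n → DvdMod A F (seq m) (seq n) := fun m n hmn => by
    induction n, hmn using Nat.le_induction with
    | base => exact .refl _
    | succ n _ ih =>
      exact ih.trans (.trans ⟨_, AddSubmonoid.subset_closure (v (seq n)).2.1, 0, zero_mem _,
        (add_zero _).symm⟩ (hseq n))
  have hfin : Finite ↥(A \ F) := (hA.subset Set.sdiff_subset)
  obtain ⟨u, hu⟩ := Finite.exists_infinite_fiber fun n => v (seq n)
  have hu' := Set.infinite_coe_iff.1 hu
  obtain ⟨N, hN⟩ := ha.exists_nsmul_not_dvdMod hA hE u.2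
  have hdvd : ∀ N : ℕ, ∃ n, DvdMod A F (a + N • (u : Fin d → ℤ)) (seq n) := fun N => by
    induction N with
    | zero => exact ⟨0, by simpa [seq] using DvdMod.refl a⟩
    | succ N ih =>
      obtain ⟨n, hn⟩ := ih
      obtain ⟨m, hm, hnm⟩ := hu'.exists_gt n
      refine ⟨m + 1, ?_⟩
      have h := hseq m
      rw [show v (seq m) = u from hm] at h
      rw [succ_nsmul, ← add_assoc]
      exact ((hn.trans (hmono n m hnm.le)).add_right _).trans h
  obtain ⟨n, hn⟩ := hdvd N
  exact hN _ (seq n).2.1 hn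

/-- The elements of `ℕA` dividing an element of `a + ℕF` for some standard pair `(a,F)` whose
overlap class is maximal. -/
def componentStd {d : ℕ} (A E F : Set (Fin d → ℤ)) : Set (Fin d → ℤ) :=
  {b | ∃ a, StdPair A E a F ∧ MaxClass A E a F ∧ ∃ y ∈ cell a F, y - b ∈ NSemi A}

theorem mem_componentStd_of_add_mem (hc : c ∈ NSemi A) (h : b + c ∈ componentStd A E F) :
    b ∈ componentStd A E F := by
  obtain ⟨a, ha, hmax, y, hy, hyb⟩ := h
  exact ⟨a, ha, hmax, y, hy, by simpa [sub_add_eq_sub_sub] using add_mem hyb hc⟩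

theorem add_mem_componentStd (hb : b ∈ componentStd A E F) (hc : c ∈ NSemi F) :
    b + c ∈ componentStd A E F := by
  obtain ⟨a, ha, hmax, _, ⟨f, hf, rfl⟩, hyb⟩ := hb
  exact ⟨a, ha, hmax, _, ⟨f + c, add_mem hf hc, rfl⟩, by
    rwa [← add_assoc, add_sub_add_right_eq_sub]⟩

theorem zero_mem_componentStd (hA : A.Finite) (hE : IsExpSet A E) (ha : StdPair A E a F) :
    0 ∈ componentStd A E F := by
  obtain ⟨b, hb, hmax⟩ := exists_maxClass hA hE ha
  exact ⟨b, hb, hmax, b, self_mem_cell, by simpa using hb.1.1⟩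

theorem notMem_of_mem_componentStd (hE : IsExpSet A E) (hb : b ∈ componentStd A E F) :
    b ∉ E := by
  obtain ⟨a, ha, -, y, hy, hyb⟩ := hb
  intro hbE
  exact (ha.1.2.2 hy).2 (by simpa using hE.2 b hbE _ hyb)

theorem exists_nsmul_notMem_componentStd (hA : A.Finite) (hF : IsFace A F)
    (hv : v ∈ A \ F) : ∃ N : ℕ, N • v ∉ componentStd A E F := by
  by_contra! hcon
  choose a ha hmax y hy hyb using hcon
  choose f hf hyf using hy
  let s : ℕ → NSemi A × NSemi A × NSemi F := fun N =>
    (⟨a N, (ha N).1.1⟩, ⟨y N - N • v, hyb N⟩, ⟨f N, hf N⟩)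
  have := isPreorder_NSemi (S := A)
  obtain ⟨i, j, hij, h₁, h₂, h₃⟩ := (wellQuasiOrdered_NSemi hA).prod
    ((wellQuasiOrdered_NSemi hA).prod (wellQuasiOrdered_NSemi (hA.subset hF.1))) s
  simp only [s] at h₁ h₂ h₃
  obtain ⟨e, he, g, hg, heg⟩ := pairDvd_iff_dvdMod.1 (hmax i (a j) F (ha j)
    (pairDvd_iff_dvdMod.2 ⟨_, h₁, 0, zero_mem _, by abel⟩))
  obtain ⟨m, rfl⟩ := Nat.exists_eq_add_of_lt hij
  have hvA : v ∈ NSemi A := AddSubmonoid.subset_closure hv.1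
  refine hv.2 (hF.mem_of_mem_NSemi hA hv.1 (hF.left_mem_of_add_mem hA hvA
    (add_mem (nsmul_mem hvA m) (add_mem h₂ he)) ?_))
  have : v + (m • v + (y (i + m + 1) - (i + m + 1) • v - (y i - i • v) + e)) =
      g + (f (i + m + 1) - f i) := by
    rw [hyf, hyf, eq_sub_of_add_eq heg]
    simp only [add_smul, one_smul]
    abel
  rw [this]
  exact add_mem hg h₃

end StdPair

section MonomialIdeal

variable {d : ℕ} {k : Type*} [Field k] {A : Set (Fin d → ℤ)}

instance : NoZeroDivisors (SGRing k A) :=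
  have : UniqueSums (NSemi A) :=
    .of_injective_addHom (NSemi A).subtype.toAddHom Subtype.val_injective inferInstance
  inferInstance

theorem support_coeff_mono (a : NSemi A) : (mono k A a).coeff.support = {a} := by
  simp [mono]

theorem mem_span_mono_iff {P : Set (NSemi A)} (hP : ∀ m ∈ P, ∀ c, c + m ∈ P) {x : SGRing k A} :
    x ∈ Ideal.span (mono k A '' P) ↔ ∀ m ∈ x.coeff.support, m ∈ P := by
  refine AddMonoidAlgebra.mem_ideal_span_of'_image.trans
    (forall₂_congr fun m _ => ⟨?_, fun hm => ⟨m, hm, 0, by simp⟩⟩)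
  rintro ⟨m', hm', c, rfl⟩
  exact hP m' hm' c

theorem isExpSet_expSet (I : Ideal (SGRing k A)) : IsExpSet A (expSet k A I) := by
  refine ⟨fun x hx => hx.1, fun x hx c hc => ⟨add_mem hx.1 hc, ?_⟩⟩
  have := I.mul_mem_right (mono k A ⟨c, hc⟩) hx.2
  simpa [mono, AddMonoidAlgebra.single_mul_single] using this

/-- Elements supported in a submonoid of exponents, powers included. -/
theorem support_coeff_pow_subset {Q : AddSubmonoid (NSemi A)} {x : SGRing k A}
    (hx : ∀ m ∈ x.coeff.support, m ∈ Q) (n : ℕ) : ∀ m ∈ (x ^ n).coeff.support, m ∈ Q := by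
  classical
  induction n with
  | zero =>
    intro m hm
    rw [pow_zero, AddMonoidAlgebra.one_def, AddMonoidAlgebra.coeff_single] at hm
    have := Finsupp.support_single_subset hm
    rw [Finset.mem_singleton.1 this]
    exact zero_mem _
  | succ n ih =>
    intro m hm
    rw [pow_succ] at hm
    obtain ⟨a, ha, b, hb, rfl⟩ := Finset.mem_add.1
      (AddMonoidAlgebra.support_coeff_mul_subset _ _ hm)
    exact add_mem (ih a ha) (hx b hb)

theorem exists_add_eq_of_set (P : Set (NSemi A)) (x : SGRing k A) :
    ∃ x₁ x₂ : SGRing k A, x = x₁ + x₂ ∧ (∀ m ∈ x₁.coeff.support, m ∉ P) ∧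
      (∀ m ∈ x₂.coeff.support, m ∈ P) := by
  classical
  refine ⟨.ofCoeff (x.coeff.filter (· ∉ P)), .ofCoeff (x.coeff.filter (· ∈ P)), ?_, ?_, ?_⟩
  · apply AddMonoidAlgebra.coeff_injective
    rw [AddMonoidAlgebra.coeff_add, add_comm]
    exact (Finsupp.filter_add_filter_not _ _).symm
  · intro m hm
    exact (by simpa using hm : _ ∧ _).2
  · intro m hm
    exact (by simpa using hm : _ ∧ _).2

/-- Let `P` be the exponent set of a monomial ideal, and `Q` a submonoid of exponents such that
adding elements of `Q` preserves the complement of `P`. If the monomials outside `Q` lie in the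
radical of the ideal, then elements with a term in `Q` are nonzerodivisors modulo the ideal. -/
theorem mem_of_mul_mem_of_notMem {P : Set (NSemi A)} {Q : AddSubmonoid (NSemi A)}
    (hP : ∀ m ∈ P, ∀ c, c + m ∈ P) (hQ : ∀ m ∉ P, ∀ c ∈ Q, m + c ∉ P)
    (hrad : ∀ y : SGRing k A, (∀ m ∈ y.coeff.support, m ∉ Q) →
      y ∈ (Ideal.span (mono k A '' P)).radical)
    {x y : SGRing k A} (hxy : x * y ∈ Ideal.span (mono k A '' P))
    (hy : ∃ m ∈ y.coeff.support, m ∈ Q) : x ∈ Ideal.span (mono k A '' P) := by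
  classical
  set C := Ideal.span (mono k A '' P)
  obtain ⟨y₁, y₂, rfl, hy₁, hy₂⟩ := exists_add_eq_of_set (Q : Set (NSemi A))ᶜ y
  simp only [Set.mem_compl_iff, SetLike.mem_coe, not_not] at hy₁ hy₂
  have hy₁0 : y₁ ≠ 0 := by
    rintro rfl
    obtain ⟨m, hm, hmQ⟩ := hy
    rw [zero_add] at hm
    exact hy₂ m hm hmQ
  obtain ⟨n, hn⟩ := hrad y₂ hy₂
  have hxy₁ : x * y₁ ^ n ∈ C := by
    obtain ⟨z, hz⟩ := sub_dvd_pow_sub_pow y₁ (-y₂) n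
    rw [sub_neg_eq_add] at hz
    have h : x * y₁ ^ n = x * (y₁ + y₂) * z + x * (-1) ^ n * y₂ ^ n := by
      rw [mul_assoc x, ← hz, neg_pow]
      ring
    rw [h]
    exact add_mem (C.mul_mem_right _ hxy) (C.mul_mem_left _ hn)
  obtain ⟨x₁, x₂, rfl, hx₁, hx₂⟩ := exists_add_eq_of_set P x
  have hx₂C : x₂ ∈ C := (mem_span_mono_iff hP).2 hx₂
  have hmem : x₁ * y₁ ^ n ∈ C := by
    rw [add_mul] at hxy₁
    exact (C.add_mem_iff_left (C.mul_mem_right _ hx₂C)).1 hxy₁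
  have hzero : x₁ * y₁ ^ n = 0 := by
    apply AddMonoidAlgebra.coeff_injective
    rw [AddMonoidAlgebra.coeff_zero, ← Finsupp.support_eq_empty,
      Finset.eq_empty_iff_forall_notMem]
    intro m hm
    obtain ⟨a, ha, b, hb, rfl⟩ := Finset.mem_add.1
      (AddMonoidAlgebra.support_coeff_mul_subset _ _ hm)
    exact hQ a (hx₁ a ha) b (support_coeff_pow_subset hy₁ n b hb)
      ((mem_span_mono_iff hP).1 hmem _ hm)
  rw [(mul_eq_zero.1 hzero).resolve_right (pow_ne_zero n hy₁0), zero_add]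
  exact hx₂C

end MonomialIdeal

/-- Let `I` be a monomial ideal with a standard pair belonging to the
face `F`, and let `S` be the set of `b ∈ ℕA` dividing some element of `a + ℕF` for some
standard pair `(a,F)` of `I` whose overlap class is maximal with respect to divisibility.
Then `ℕA ∖ S` is the exponent set of a monomial ideal `C_F ⊇ I`, and `C_F` is
`p_F`-primary. -/
theorem component_CF_primary {d : ℕ} (k : Type*) [Field k]
    (A : Set (Fin d → ℤ)) (hA : IsConfig A)
    (F : Set (Fin d → ℤ)) (hF : IsFace A F)
    (I : Ideal (SGRing k A)) (hI : IsMonomialIdeal k A I)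
    (hex : ∃ a, StdPair A (expSet k A I) a F) :
    ∃ CF : Ideal (SGRing k A), IsMonomialIdeal k A CF ∧
      (∀ b, ∀ hb : b ∈ NSemi A, (mono k A ⟨b, hb⟩ ∈ CF ↔
        ¬ ∃ a, StdPair A (expSet k A I) a F ∧ MaxClass A (expSet k A I) a F ∧
          ∃ y ∈ cell a F, y - b ∈ NSemi A)) ∧
      I ≤ CF ∧ CF.IsPrimary ∧ CF.radical = primeF k A F := by
  obtain ⟨a₀, ha₀⟩ := hex
  set E := expSet k A I
  have hE : IsExpSet A E := isExpSet_expSet I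
  let P : Set (NSemi A) := {m | (m : Fin d → ℤ) ∉ componentStd A E F}
  let Q : AddSubmonoid (NSemi A) := (NSemi F).comap (NSemi A).subtype
  have hP : ∀ m ∈ P, ∀ c, c + m ∈ P := fun m hm c h =>
    hm (mem_componentStd_of_add_mem c.2 (by rwa [add_comm] at h))
  have hQ : ∀ m ∉ P, ∀ c ∈ Q, m + c ∉ P := fun m hm c hc =>
    not_not.2 (add_mem_componentStd (not_not.1 hm) hc)
  have hzero : (0 : NSemi A) ∉ P := not_not.2 (zero_mem_componentStd hA.finite hE ha₀)
  have hprime : primeF k A F = Ideal.span (mono k A '' {m | m ∉ Q}) := by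
    refine congrArg Ideal.span (Set.ext fun x => ?_)
    exact exists_congr fun a => and_congr_right fun _ => eq_comm
  have hQc : ∀ m ∈ {m | m ∉ Q}, ∀ c, c + m ∈ {m | m ∉ Q} := fun m hm c h =>
    hm (hF.left_mem_of_add_mem hA.finite m.2 c.2 (by rwa [add_comm] at h))
  set C := Ideal.span (mono k A '' P)
  have hrad : primeF k A F ≤ C.radical := by
    rw [hprime, Ideal.span_le]
    rintro _ ⟨m, hm, rfl⟩
    obtain ⟨v, hv, hmv⟩ := exists_mem_diff_sub_mem m.2 hm
    obtain ⟨N, hN⟩ := exists_nsmul_notMem_componentStd (E := E) hA.finite hF hv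
    refine ⟨N, Ideal.subset_span ⟨N • m, fun h => hN ?_, ?_⟩⟩
    · refine mem_componentStd_of_add_mem (nsmul_mem hmv N) ?_
      rw [← smul_add, add_sub_cancel]
      exact h
    · simp [mono, AddMonoidAlgebra.single_pow]
  have hcancel : ∀ {x y : SGRing k A}, x * y ∈ C → y ∉ primeF k A F → x ∈ C := by
    intro x y hxy hy
    refine mem_of_mul_mem_of_notMem hP hQ (fun z hz => hrad ?_) hxy ?_
    · rw [hprime, mem_span_mono_iff hQc]
      exact hz
    · rw [hprime, mem_span_mono_iff hQc] at hy
      push Not at hy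
      obtain ⟨m, hm, hmQ⟩ := hy
      exact ⟨m, hm, not_not.1 hmQ⟩
  have hone : (1 : SGRing k A) ∉ C := fun h =>
    hzero ((mem_span_mono_iff hP).1 h 0 (by simp [AddMonoidAlgebra.one_def]))
  have hradeq : C.radical = primeF k A F := by
    refine le_antisymm (fun y hy => ?_) hrad
    by_contra hyF
    obtain ⟨n, hn⟩ := hy
    induction n with
    | zero => exact hone (by simpa using hn)
    | succ n ih => exact ih (hcancel (by rwa [pow_succ] at hn) hyF)
  refine ⟨C, ⟨P, rfl⟩, fun b hb => ?_, ?_, ?_, hradeq⟩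
  · rw [mem_span_mono_iff hP]
    simp [support_coeff_mono, P, componentStd]
  · obtain ⟨S, rfl⟩ := hI
    rw [Ideal.span_le]
    rintro _ ⟨m, hm, rfl⟩
    refine Ideal.subset_span ⟨m, fun h => notMem_of_mem_componentStd hE h ?_, rfl⟩
    exact ⟨m.2, Ideal.subset_span ⟨m, hm, rfl⟩⟩
  · rw [Ideal.isPrimary_iff, hradeq]
    refine ⟨(Ideal.ne_top_iff_one C).2 hone, fun {x y} hxy => ?_⟩
    by_cases hy : y ∈ primeF k A F
    · exact .inr hy
    · exact .inl (hcancel hxy hy)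

end StdPairsPaper
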